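/- Fix H > 0, B > 1, and a, b > 0 with a² ≤ b². Let x(r) = (1/H)·√(1 + B² + 2B·sin(Hr + 3π/2)), z(r) = ∫_{3π/(2H)}^{r + 3π/(2H)} (1 + B·sin(Ht))/√(1 + B² + 2B·sin(Ht)) dt, r₀ = (1/H)·arcsin(−1/B) + π/(2H), and ρ(r) = x(r) − (x'(r)/z'(r))·z(r)·(b²/a²), and let r̄ ∈ (0, r₀) satisfy ρ(r̄) = 0. Then for all r ∈ [−r̄, r̄]: ρ(r) ≥ 0 and x'(r)·z(r) ≤ 0; consequently, with g(r) = −x(r)z'(r) + x'(r)z(r)·(b²/a²), k₁(r) = x'(r)z''(r) − x''(r)z'(r), and k₂(r) = z'(r)/x(r), the pinching inequality ((k₁(r) − k₂(r))²/2)·g(r)² ≤ (1/2)·(2 + (k₁(r) + k₂(r))·g(r))² holds for all r ∈ [−r̄, r̄]. -/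

import Mathlib

open Real

/-- Kenmotsu's profile function `x(s) = (1/H)√(1 + B² + 2B sin(Hs + 3π/2))`. -/
noncomputable def kenX (H B : ℝ) (s : ℝ) : ℝ :=
  (1 / H) * Real.sqrt (1 + B ^ 2 + 2 * B * Real.sin (H * s + 3 * Real.pi / 2))

/-- Kenmotsu's height function
`z(s) = ∫_{3π/(2H)}^{s + 3π/(2H)} (1 + B sin(Ht))/√(1 + B² + 2B sin(Ht)) dt`. -/
noncomputable def kenZ (H B : ℝ) (s : ℝ) : ℝ :=
  ∫ t in (3 * Real.pi / (2 * H))..(s + 3 * Real.pi / (2 * H)),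
    (1 + B * Real.sin (H * t)) / Real.sqrt (1 + B ^ 2 + 2 * B * Real.sin (H * t))

/-- The function `ρ` of the Kenmotsu nodoid. -/
noncomputable def kenRho (H B a b : ℝ) (r : ℝ) : ℝ :=
  kenX H B r - (deriv (kenX H B) r / deriv (kenZ H B) r) * kenZ H B r *
    (b ^ 2 / a ^ 2)

section Kenmotsu

variable {H B : ℝ}

lemma kenmotsu_radicand_pos (hB : 1 < B) (θ : ℝ) : 0 < 1 + B ^ 2 - 2 * B * cos θ := by
  nlinarith [cos_le_one θ, sq_pos_of_pos (sub_pos.2 hB)]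

lemma sin_add_three_pi_div_two (θ : ℝ) : sin (θ + 3 * π / 2) = -cos θ := by
  rw [show θ + 3 * π / 2 = θ + π / 2 + π by ring, sin_add_pi, sin_add_pi_div_two]

lemma kenX_eq (H B s : ℝ) : kenX H B s = (1 / H) * √(1 + B ^ 2 - 2 * B * cos (H * s)) := by
  rw [kenX, sin_add_three_pi_div_two]
  ring_nf

lemma hasDerivAt_sqrt_kenmotsu_radicand (hB : 1 < B) (s : ℝ) :
    HasDerivAt (fun s => √(1 + B ^ 2 - 2 * B * cos (H * s)))
      (H * B * sin (H * s) / √(1 + B ^ 2 - 2 * B * cos (H * s))) s := by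
  have hθ : HasDerivAt (fun s : ℝ => H * s) H s := by
    simpa using (hasDerivAt_id s).const_mul H
  have h := ((hθ.cos.const_mul (2 * B)).const_sub (1 + B ^ 2)).sqrt
    (kenmotsu_radicand_pos hB (H * s)).ne'
  refine h.congr_deriv ?_
  field_simp

lemma hasDerivAt_kenX (hH : 0 < H) (hB : 1 < B) (s : ℝ) :
    HasDerivAt (kenX H B) (B * sin (H * s) / √(1 + B ^ 2 - 2 * B * cos (H * s))) s := by
  rw [show kenX H B = _ from funext (kenX_eq H B)]
  refine ((hasDerivAt_sqrt_kenmotsu_radicand (H := H) hB s).const_mul (1 / H)).congr_deriv ?_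
  field_simp

lemma hasDerivAt_kenZ (hH : 0 < H) (hB : 1 < B) (s : ℝ) :
    HasDerivAt (kenZ H B)
      ((1 - B * cos (H * s)) / √(1 + B ^ 2 - 2 * B * cos (H * s))) s := by
  have hpos (t : ℝ) : 0 < 1 + B ^ 2 + 2 * B * sin (H * t) := by
    nlinarith [neg_one_le_sin (H * t), sq_pos_of_pos (sub_pos.2 hB)]
  have hc : Continuous fun t : ℝ =>
      (1 + B * sin (H * t)) / √(1 + B ^ 2 + 2 * B * sin (H * t)) :=
    Continuous.div (by fun_prop) (by fun_prop) fun t => (sqrt_pos.2 (hpos t)).ne'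
  have h := (hc.integral_hasStrictDerivAt (3 * π / (2 * H))
    (s + 3 * π / (2 * H))).hasDerivAt.comp_add_const s (3 * π / (2 * H))
  have hsin : sin (H * (s + 3 * π / (2 * H))) = -cos (H * s) := by
    rw [← sin_add_three_pi_div_two]
    congr 1
    field_simp
  rw [hsin] at h
  refine h.congr_deriv ?_
  ring_nf

lemma kenZ_zero (H B : ℝ) : kenZ H B 0 = 0 := by simp [kenZ]

lemma kenX_neg (H B s : ℝ) : kenX H B (-s) = kenX H B s := by simp [kenX_eq]

lemma kenZ_neg (hH : 0 < H) (hB : 1 < B) (s : ℝ) : kenZ H B (-s) = -kenZ H B s := by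
  have hd (t : ℝ) : HasDerivAt (fun t => kenZ H B (-t) + kenZ H B t) 0 t := by
    refine (((hasDerivAt_kenZ hH hB (-t)).scomp t (hasDerivAt_neg t)).add
      (hasDerivAt_kenZ hH hB t)).congr_deriv ?_
    simp
  have h := is_const_of_deriv_eq_zero (fun t => (hd t).differentiableAt)
    (fun t => (hd t).deriv) s 0
  simp only [neg_zero, kenZ_zero, add_zero] at h
  linarith

lemma deriv_kenX (hH : 0 < H) (hB : 1 < B) :
    deriv (kenX H B) =
      fun s => B * sin (H * s) / √(1 + B ^ 2 - 2 * B * cos (H * s)) :=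
  funext fun s => (hasDerivAt_kenX hH hB s).deriv

lemma deriv_kenZ (hH : 0 < H) (hB : 1 < B) :
    deriv (kenZ H B) =
      fun s => (1 - B * cos (H * s)) / √(1 + B ^ 2 - 2 * B * cos (H * s)) :=
  funext fun s => (hasDerivAt_kenZ hH hB s).deriv

lemma deriv_deriv_kenX (hH : 0 < H) (hB : 1 < B) (s : ℝ) :
    deriv (deriv (kenX H B)) s =
      H * B * (cos (H * s) - B) * (1 - B * cos (H * s)) /
        √(1 + B ^ 2 - 2 * B * cos (H * s)) ^ 3 := by
  have hpos := kenmotsu_radicand_pos hB (H * s)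
  have hθ : HasDerivAt (fun s : ℝ => H * s) H s := by
    simpa using (hasDerivAt_id s).const_mul H
  have hw := (sqrt_pos.2 hpos).ne'
  rw [deriv_kenX hH hB]
  refine ((hθ.sin.const_mul B).div
    (hasDerivAt_sqrt_kenmotsu_radicand hB s) hw).deriv.trans ?_
  have hsq := sq_sqrt hpos.le
  generalize √(1 + B ^ 2 - 2 * B * cos (H * s)) = w at hw hsq ⊢
  field_simp
  rw [hsq, sin_sq]
  ring

lemma deriv_deriv_kenZ (hH : 0 < H) (hB : 1 < B) (s : ℝ) :
    deriv (deriv (kenZ H B)) s =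
      H * B ^ 2 * sin (H * s) * (B - cos (H * s)) /
        √(1 + B ^ 2 - 2 * B * cos (H * s)) ^ 3 := by
  have hpos := kenmotsu_radicand_pos hB (H * s)
  have hθ : HasDerivAt (fun s : ℝ => H * s) H s := by
    simpa using (hasDerivAt_id s).const_mul H
  have hw := (sqrt_pos.2 hpos).ne'
  rw [deriv_kenZ hH hB]
  refine (((hθ.cos.const_mul B).const_sub 1).div
    (hasDerivAt_sqrt_kenmotsu_radicand hB s) hw).deriv.trans ?_
  have hsq := sq_sqrt hpos.le
  generalize √(1 + B ^ 2 - 2 * B * cos (H * s)) = w at hw hsq ⊢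
  field_simp
  rw [hsq]
  ring

/-- The generating curve is parametrized by arc length. -/
lemma deriv_kenX_sq_add_deriv_kenZ_sq (hH : 0 < H) (hB : 1 < B) (s : ℝ) :
    deriv (kenX H B) s ^ 2 + deriv (kenZ H B) s ^ 2 = 1 := by
  have hpos := kenmotsu_radicand_pos hB (H * s)
  simp only [deriv_kenX hH hB, deriv_kenZ hH hB, div_pow, sq_sqrt hpos.le]
  rw [← add_div, div_eq_one_iff_eq hpos.ne', mul_pow, sin_sq]
  ring

/-- The principal curvature of the rotated surface along the generating curve is positive. -/
lemma kenmotsu_curvature_pos (hH : 0 < H) (hB : 1 < B) (s : ℝ) :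
    0 < deriv (kenX H B) s * deriv (deriv (kenZ H B)) s -
      deriv (deriv (kenX H B)) s * deriv (kenZ H B) s := by
  have hpos := kenmotsu_radicand_pos hB (H * s)
  have hw := sqrt_pos.2 hpos
  have hsq := sq_sqrt hpos.le
  have h : deriv (kenX H B) s * deriv (deriv (kenZ H B)) s -
      deriv (deriv (kenX H B)) s * deriv (kenZ H B) s =
        H * B * (B - cos (H * s)) / (1 + B ^ 2 - 2 * B * cos (H * s)) := by
    rw [deriv_deriv_kenX hH hB, deriv_deriv_kenZ hH hB, deriv_kenX hH hB, deriv_kenZ hH hB]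
    simp only
    conv_rhs => rw [← hsq]
    generalize √(1 + B ^ 2 - 2 * B * cos (H * s)) = w at hw hsq ⊢
    field_simp
    rw [hsq, sin_sq]
    ring
  rw [h]
  have := cos_le_one (H * s)
  have : 0 < B - cos (H * s) := by linarith
  positivity

/-- Below the first zero `r₀` of `z'`, `cos (H r)` exceeds `1 / B`. -/
lemma one_lt_mul_cos_of_abs_lt (hH : 0 < H) (hB : 1 < B) {r : ℝ}
    (hr : |r| < (1 / H) * arcsin (-(1 / B)) + π / (2 * H)) : 1 < B * cos (H * r) := by
  have hB0 : 0 < B := by linarith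
  have hlt : H * |r| < arcsin (-(1 / B)) + π / 2 := by
    calc H * |r| < H * ((1 / H) * arcsin (-(1 / B)) + π / (2 * H)) := by gcongr
      _ = _ := by field_simp
  have hle : 1 / B ≤ 1 := by rw [div_le_one hB0]; exact hB.le
  have h0 : (0 : ℝ) < 1 / B := by positivity
  have hcos : cos (arcsin (-(1 / B)) + π / 2) = 1 / B := by
    rw [cos_add_pi_div_two, sin_arcsin (by linarith) (by linarith), neg_neg]
  have h := cos_lt_cos_of_nonneg_of_le_pi (by positivity)
    (by linarith [arcsin_le_pi_div_two (-(1 / B))]) hlt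
  rw [hcos, ← abs_of_pos hH, ← abs_mul, cos_abs, div_lt_iff₀ hB0] at h
  linarith

lemma deriv_kenZ_lt_zero (hH : 0 < H) (hB : 1 < B) {r : ℝ} (hr : 1 < B * cos (H * r)) :
    deriv (kenZ H B) r < 0 := by
  rw [deriv_kenZ hH hB]
  exact div_neg_of_neg_of_pos (by linarith) (sqrt_pos.2 (kenmotsu_radicand_pos hB _))

lemma kenZ_nonpos (hH : 0 < H) (hB : 1 < B) {r : ℝ} (hr0 : 0 ≤ r)
    (hr : r < (1 / H) * arcsin (-(1 / B)) + π / (2 * H)) : kenZ H B r ≤ 0 := by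
  have h : AntitoneOn (kenZ H B) (Set.Icc 0 r) := by
    refine antitoneOn_of_deriv_nonpos (convex_Icc 0 r)
      (fun s _ => (hasDerivAt_kenZ hH hB s).continuousAt.continuousWithinAt)
      (fun s _ => (hasDerivAt_kenZ hH hB s).differentiableAt.differentiableWithinAt) ?_
    intro s hs
    rw [interior_Icc] at hs
    refine (deriv_kenZ_lt_zero hH hB (one_lt_mul_cos_of_abs_lt hH hB ?_)).le
    rw [abs_of_pos hs.1]
    exact hs.2.trans hr
  simpa [kenZ_zero] using h (Set.left_mem_Icc.2 hr0) (Set.right_mem_Icc.2 hr0) hr0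

lemma deriv_kenX_nonneg (hH : 0 < H) (hB : 1 < B) {r : ℝ} (hr0 : 0 ≤ r)
    (hr : r < (1 / H) * arcsin (-(1 / B)) + π / (2 * H)) : 0 ≤ deriv (kenX H B) r := by
  have hlt : H * r < arcsin (-(1 / B)) + π / 2 := by
    calc H * r < H * ((1 / H) * arcsin (-(1 / B)) + π / (2 * H)) := by gcongr
      _ = _ := by field_simp
  have hs : 0 ≤ sin (H * r) := sin_nonneg_of_nonneg_of_le_pi (by positivity)
    (by linarith [arcsin_le_pi_div_two (-(1 / B))])
  rw [deriv_kenX hH hB]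
  positivity

lemma deriv_kenX_comp_neg (hH : 0 < H) (hB : 1 < B) (r : ℝ) :
    deriv (kenX H B) (-r) = -deriv (kenX H B) r := by
  simp [deriv_kenX hH hB, neg_div]

lemma deriv_kenZ_comp_neg (hH : 0 < H) (hB : 1 < B) (r : ℝ) :
    deriv (kenZ H B) (-r) = deriv (kenZ H B) r := by
  simp [deriv_kenZ hH hB]

lemma deriv_kenX_mul_kenZ_nonpos (hH : 0 < H) (hB : 1 < B) {r : ℝ}
    (hr : |r| < (1 / H) * arcsin (-(1 / B)) + π / (2 * H)) :
    deriv (kenX H B) r * kenZ H B r ≤ 0 := by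
  have h := mul_nonpos_of_nonneg_of_nonpos (deriv_kenX_nonneg hH hB (abs_nonneg r) hr)
    (kenZ_nonpos hH hB (abs_nonneg r) hr)
  rcases abs_choice r with h' | h' <;> rw [h'] at h
  · exact h
  · rwa [deriv_kenX_comp_neg hH hB, kenZ_neg hH hB, neg_mul_neg] at h

lemma kenRho_neg (hH : 0 < H) (hB : 1 < B) (a b r : ℝ) :
    kenRho H B a b (-r) = kenRho H B a b r := by
  simp only [kenRho, kenX_neg, kenZ_neg hH hB, deriv_kenX_comp_neg hH hB, deriv_kenZ_comp_neg hH hB]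
  ring

lemma deriv_kenX_div_deriv_kenZ (hH : 0 < H) (hB : 1 < B) (s : ℝ) :
    deriv (kenX H B) s / deriv (kenZ H B) s = B * sin (H * s) / (1 - B * cos (H * s)) := by
  rw [deriv_kenX hH hB, deriv_kenZ hH hB]
  exact div_div_div_cancel_right₀ (sqrt_pos.2 (kenmotsu_radicand_pos hB _)).ne' _ _

lemma hasDerivAt_kenRho (hH : 0 < H) (hB : 1 < B) (a b : ℝ) {s : ℝ}
    (hs : 1 < B * cos (H * s)) :
    HasDerivAt (kenRho H B a b)
      (deriv (kenX H B) s * (1 - b ^ 2 / a ^ 2) +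
        H * B * (B - cos (H * s)) / (1 - B * cos (H * s)) ^ 2 * kenZ H B s *
          (b ^ 2 / a ^ 2)) s := by
  have hd : 1 - B * cos (H * s) ≠ 0 := by linarith
  have hθ : HasDerivAt (fun s : ℝ => H * s) H s := by
    simpa using (hasDerivAt_id s).const_mul H
  have hq := (hθ.sin.const_mul B).div ((hθ.cos.const_mul B).const_sub 1) hd
  have h := (hasDerivAt_kenX hH hB s).sub
    ((hq.mul (hasDerivAt_kenZ hH hB s)).mul_const (b ^ 2 / a ^ 2))
  have hfun : kenRho H B a b = fun s => kenX H B s -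
      B * sin (H * s) / (1 - B * cos (H * s)) * kenZ H B s * (b ^ 2 / a ^ 2) := by
    funext t
    rw [kenRho, deriv_kenX_div_deriv_kenZ hH hB]
  rw [hfun]
  refine h.congr_deriv ?_
  rw [deriv_kenX hH hB]
  have hw := (sqrt_pos.2 (kenmotsu_radicand_pos hB (H * s))).ne'
  simp only [Pi.div_apply]
  generalize √(1 + B ^ 2 - 2 * B * cos (H * s)) = w at hw ⊢
  generalize b ^ 2 / a ^ 2 = c
  have hsc := sin_sq (H * s)
  field_simp
  linear_combination (H * B * w * kenZ H B s * c) * hsc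

lemma antitoneOn_kenRho (hH : 0 < H) (hB : 1 < B) {a b : ℝ} (ha : 0 < a)
    (hab : a ^ 2 ≤ b ^ 2) {r : ℝ}
    (hr : r < (1 / H) * arcsin (-(1 / B)) + π / (2 * H)) :
    AntitoneOn (kenRho H B a b) (Set.Icc 0 r) := by
  have hcos {s : ℝ} (hs : s ∈ Set.Icc 0 r) : 1 < B * cos (H * s) :=
    one_lt_mul_cos_of_abs_lt hH hB (by rw [abs_of_nonneg hs.1]; exact hs.2.trans_lt hr)
  refine antitoneOn_of_deriv_nonpos (convex_Icc 0 r)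
    (fun s hs => (hasDerivAt_kenRho hH hB a b (hcos hs)).continuousAt.continuousWithinAt)
    (fun s hs => (hasDerivAt_kenRho hH hB a b
      (hcos (interior_subset hs))).differentiableAt.differentiableWithinAt) ?_
  intro s hs
  replace hs := interior_subset hs
  have hsr := hs.2.trans_lt hr
  rw [(hasDerivAt_kenRho hH hB a b (hcos hs)).deriv]
  have hc : 1 ≤ b ^ 2 / a ^ 2 := (one_le_div (by positivity)).2 hab
  have hBc : 0 ≤ B - cos (H * s) := by linarith [cos_le_one (H * s)]
  refine add_nonpos (mul_nonpos_of_nonneg_of_nonpos (deriv_kenX_nonneg hH hB hs.1 hsr)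
    (by linarith)) (mul_nonpos_of_nonpos_of_nonneg (mul_nonpos_of_nonneg_of_nonpos
      (by positivity) (kenZ_nonpos hH hB hs.1 hsr)) (by positivity))

end Kenmotsu

/-- The pinching inequality is equivalent to `(1 + k₁ g) (1 + k₂ g) ≥ 0`. -/
lemma pinching_of_one_add_mul_nonneg {k₁ k₂ g : ℝ} (h₁ : 0 ≤ 1 + k₁ * g)
    (h₂ : 0 ≤ 1 + k₂ * g) :
    (k₁ - k₂) ^ 2 / 2 * g ^ 2 ≤ 1 / 2 * (2 + (k₁ + k₂) * g) ^ 2 := by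
  linarith [mul_nonneg h₁ h₂]

/-- For the nodoid (`B > 1`) with `a² ≤ b²`: if `r̄ ∈ (0, r₀)` satisfies
`ρ(r̄) = 0`, then on `[-r̄, r̄]` one has `ρ ≥ 0` and `x' z ≤ 0`, and the pinching
inequality `((k₁-k₂)²/2) g² ≤ (1/2)(2 + (k₁+k₂) g)²` holds, where
`g = -x z' + x' z (b²/a²)`, `k₁ = x' z'' - x'' z'` and `k₂ = z'/x` and
`r₀ = (1/H) arcsin(-1/B) + π/(2H)`. -/
theorem nodoid_pinching (H B a b : ℝ) (hH : 0 < H) (hB : 1 < B)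
    (ha : 0 < a) (hb : 0 < b) (hab : a ^ 2 ≤ b ^ 2)
    (rb : ℝ)
    (hrb : rb ∈ Set.Ioo (0 : ℝ) ((1 / H) * Real.arcsin (-(1 / B)) + Real.pi / (2 * H)))
    (hrho : kenRho H B a b rb = 0) :
    ∀ r ∈ Set.Icc (-rb) rb,
      0 ≤ kenRho H B a b r ∧
      deriv (kenX H B) r * kenZ H B r ≤ 0 ∧
      (((deriv (kenX H B) r * deriv (deriv (kenZ H B)) r -
            deriv (deriv (kenX H B)) r * deriv (kenZ H B) r) -
            deriv (kenZ H B) r / kenX H B r) ^ 2 / 2) *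
          (-(kenX H B r) * deriv (kenZ H B) r +
            deriv (kenX H B) r * kenZ H B r * (b ^ 2 / a ^ 2)) ^ 2 ≤
        (1 / 2) *
          (2 + ((deriv (kenX H B) r * deriv (deriv (kenZ H B)) r -
              deriv (deriv (kenX H B)) r * deriv (kenZ H B) r) +
              deriv (kenZ H B) r / kenX H B r) *
            (-(kenX H B r) * deriv (kenZ H B) r +
              deriv (kenX H B) r * kenZ H B r * (b ^ 2 / a ^ 2))) ^ 2 := by
  intro r hr
  have hr' : |r| ≤ rb := abs_le.2 hr
  have hlt := hr'.trans_lt hrb.2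
  have hρ : 0 ≤ kenRho H B a b r := by
    have h := antitoneOn_kenRho hH hB ha hab hrb.2 ⟨abs_nonneg r, hr'⟩
      (Set.right_mem_Icc.2 hrb.1.le) hr'
    rw [hrho] at h
    rcases abs_choice r with h' | h' <;> rw [h'] at h
    · exact h
    · rwa [kenRho_neg hH hB] at h
  have hxz := deriv_kenX_mul_kenZ_nonpos hH hB hlt
  have hz' := deriv_kenZ_lt_zero hH hB (one_lt_mul_cos_of_abs_lt hH hB hlt)
  have hx : 0 < kenX H B r := by
    rw [kenX_eq]
    have := sqrt_pos.2 (kenmotsu_radicand_pos hB (H * r))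
    positivity
  have hg : -(kenX H B r) * deriv (kenZ H B) r +
      deriv (kenX H B) r * kenZ H B r * (b ^ 2 / a ^ 2) =
        -deriv (kenZ H B) r * kenRho H B a b r := by
    rw [kenRho]
    field_simp [hz'.ne]
    ring
  refine ⟨hρ, hxz, pinching_of_one_add_mul_nonneg ?_ ?_⟩
  · rw [hg]
    have := mul_nonneg (kenmotsu_curvature_pos hH hB r).le
      (mul_nonneg (neg_nonneg.2 hz'.le) hρ)
    linarith
  · have h : 1 + deriv (kenZ H B) r / kenX H B r * (-(kenX H B r) * deriv (kenZ H B) r +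
        deriv (kenX H B) r * kenZ H B r * (b ^ 2 / a ^ 2)) =
        deriv (kenX H B) r ^ 2 + deriv (kenZ H B) r * (deriv (kenX H B) r * kenZ H B r) *
          (b ^ 2 / a ^ 2) / kenX H B r := by
      rw [← deriv_kenX_sq_add_deriv_kenZ_sq hH hB r]
      field_simp
      ring
    rw [h]
    have := mul_nonneg_of_nonpos_of_nonpos hz'.le hxz
    positivity
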